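/- arXiv:0912.5200 — 4 statements merged into one kernel-verified Lean document; each statement's English description precedes it below -/
import Mathlib

section
/- Let f : ℝ^p → ℝ be a convex differentiable function, let λ_1, …, λ_p ≥ 0, and define L(β) = f(β) + Σ_{j=1}^p λ_j |β_j|. Assume L is strictly convex. Let S ⊆ {1, …, p} and suppose β̂ ∈ ℝ^p satisfies β̂_j = 0 for all j ∉ S and β̂ minimizes L over the subspace {β ∈ ℝ^p : β_j = 0 for all j ∉ S}. If in addition |∂f/∂β_j(β̂)| ≤ λ_j for every j ∉ S, then β̂ is the unique global minimizer of L over all of ℝ^p. -/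
theorem aux_deriv_nonneg (h : ℝ → ℝ) (c : ℝ) (hd : HasDerivAt h c 0)
    (hm : ∀ t, 0 < t → t ≤ 1 → h 0 ≤ h t) : 0 ≤ c := by
  have h1 := (hasDerivAt_iff_tendsto_slope.1 hd).mono_left
    (nhdsWithin_mono (0 : ℝ) (fun x (hx : x ∈ Set.Ioi (0 : ℝ)) => ne_of_gt hx))
  refine ge_of_tendsto h1 ?_
  filter_upwards [Ioc_mem_nhdsGT (zero_lt_one : (0 : ℝ) < 1)] with t ht
  rw [slope_def_field]
  exact div_nonneg (sub_nonneg.2 (hm t ht.1 ht.2)) (by linarith [ht.1])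

theorem aux_line {p : ℕ} (f : (Fin p → ℝ) → ℝ) (hdiff : Differentiable ℝ f)
    (x d : Fin p → ℝ) : HasDerivAt (fun t : ℝ => f (x + t • d)) (fderiv ℝ f x d) 0 := by
  have h1 : HasDerivAt (fun t : ℝ => x + t • d) d 0 := by
    simpa using ((hasDerivAt_id (0 : ℝ)).smul_const d).const_add x
  have h2 : HasFDerivAt f (fderiv ℝ f x) (x + (0 : ℝ) • d) := by
    simpa using (hdiff x).hasFDerivAt
  exact h2.comp_hasDerivAt (0 : ℝ) h1

/-- Deterministic core of Theorem 1: if the restricted (oracle) minimizer of the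
weighted-L1-penalized strictly convex objective, supported on `S`, satisfies dual
feasibility `|∂f/∂β_j(β̂)| ≤ λ_j` on the complement of `S`, then it is the unique
global minimizer over all of ℝ^p. -/
theorem stmt_2 {p : ℕ} (f : (Fin p → ℝ) → ℝ)
    (hconv : ConvexOn ℝ Set.univ f) (hdiff : Differentiable ℝ f)
    (lam : Fin p → ℝ) (hlam : ∀ j, 0 ≤ lam j)
    (L : (Fin p → ℝ) → ℝ)
    (hL : L = fun β => f β + ∑ j : Fin p, lam j * |β j|)
    (hstrict : StrictConvexOn ℝ Set.univ L)
    (S : Finset (Fin p)) (βhat : Fin p → ℝ)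
    (hsupp : ∀ j ∉ S, βhat j = 0)
    (hmin : ∀ β : Fin p → ℝ, (∀ j ∉ S, β j = 0) → L βhat ≤ L β)
    (hdual : ∀ j ∉ S, |fderiv ℝ f βhat (Pi.single j 1)| ≤ lam j) :
    ∀ β : Fin p → ℝ, β ≠ βhat → L βhat < L β := by
  have key : ∀ β : Fin p → ℝ, L βhat ≤ L β := by
    intro β
    obtain ⟨γ, hγ⟩ : ∃ γ : Fin p → ℝ, γ = fun j => if j ∈ S then β j else 0 := ⟨_, rfl⟩
    have hA : 0 ≤ fderiv ℝ f βhat (γ - βhat)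
        + (∑ j, lam j * |γ j| - ∑ j, lam j * |βhat j|) := by
      refine aux_deriv_nonneg (fun t => f (βhat + t • (γ - βhat))
        + t * (∑ j, lam j * |γ j| - ∑ j, lam j * |βhat j|)) _ ?_ ?_
      · have h2 := (hasDerivAt_id (0 : ℝ)).mul_const
          (∑ j, lam j * |γ j| - ∑ j, lam j * |βhat j|)
        have h3 := (aux_line f hdiff βhat (γ - βhat)).add h2
        rw [one_mul] at h3
        exact h3
      · intro t ht0 ht1
        have h1 := hmin (βhat + t • (γ - βhat)) (by
          intro j hj
          simp [hγ, hj, hsupp j hj])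
        have h2 : ∑ j, lam j * |(βhat + t • (γ - βhat)) j| ≤
            ∑ j, lam j * |βhat j|
              + t * (∑ j, lam j * |γ j| - ∑ j, lam j * |βhat j|) := by
          rw [← Finset.sum_sub_distrib, Finset.mul_sum, ← Finset.sum_add_distrib]
          refine Finset.sum_le_sum fun j _ => ?_
          have h4 : |(βhat + t • (γ - βhat)) j| ≤ (1 - t) * |βhat j| + t * |γ j| := by
            have h5 : (βhat + t • (γ - βhat)) j = (1 - t) * βhat j + t * γ j := by
              simp only [Pi.add_apply, Pi.smul_apply, Pi.sub_apply, smul_eq_mul]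
              ring
            rw [h5]
            refine (abs_add_le _ _).trans ?_
            rw [abs_mul, abs_mul, abs_of_pos ht0, abs_of_nonneg (by linarith : 0 ≤ 1 - t)]
          have h6 := mul_le_mul_of_nonneg_left h4 (hlam j)
          linarith
        simp only [hL] at h1
        simp only [zero_smul, add_zero, zero_mul]
        linarith
    have hB : 0 ≤ (f β - f βhat) - fderiv ℝ f βhat (β - βhat) := by
      refine aux_deriv_nonneg (fun t => t * (f β - f βhat) - f (βhat + t • (β - βhat))) _ ?_ ?_
      · have h2 := (hasDerivAt_id (0 : ℝ)).mul_const (f β - f βhat)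
        have h3 := h2.sub (aux_line f hdiff βhat (β - βhat))
        rw [one_mul] at h3
        exact h3
      · intro t ht0 ht1
        have h1 := hconv.2 (Set.mem_univ βhat) (Set.mem_univ β)
          (by linarith : 0 ≤ 1 - t) ht0.le (by ring)
        have h2 : (1 - t) • βhat + t • β = βhat + t • (β - βhat) := by module
        rw [h2] at h1
        simp only [smul_eq_mul] at h1
        simp only [zero_smul, add_zero, zero_mul]
        linarith
    have hC : -∑ j, lam j * |β j - γ j| ≤ fderiv ℝ f βhat (β - γ) := by
      have h1 := LinearMap.pi_apply_eq_sum_univ (fderiv ℝ f βhat).toLinearMap (β - γ)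
      have h2 : fderiv ℝ f βhat (β - γ)
          = ∑ j, (β j - γ j) * fderiv ℝ f βhat (Pi.single j 1) := by
        refine h1.trans (Finset.sum_congr rfl fun j _ => ?_)
        have h3 : (fun i => if j = i then (1 : ℝ) else 0) = Pi.single j 1 := by
          ext i
          simp [Pi.single_apply, eq_comm]
        rw [h3]
        rfl
      rw [h2, ← Finset.sum_neg_distrib]
      refine Finset.sum_le_sum fun j _ => ?_
      by_cases hj : j ∈ S
      · simp [hγ, hj]
      · have h4 := mul_le_mul_of_nonneg_left (hdual j hj) (abs_nonneg (β j - γ j))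
        rw [← abs_mul] at h4
        have h5 := neg_abs_le ((β j - γ j) * fderiv ℝ f βhat (Pi.single j 1))
        linarith
    have hD : ∑ j, lam j * |β j| = ∑ j, lam j * |γ j| + ∑ j, lam j * |β j - γ j| := by
      rw [← Finset.sum_add_distrib]
      refine Finset.sum_congr rfl fun j _ => ?_
      by_cases hj : j ∈ S <;> simp [hγ, hj]
    have hE : fderiv ℝ f βhat (β - βhat)
        = fderiv ℝ f βhat (β - γ) + fderiv ℝ f βhat (γ - βhat) := by
      rw [← map_add, sub_add_sub_cancel]
    simp only [hL]
    linarith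
  intro β hβ
  have h1 := hstrict.2 (Set.mem_univ β) (Set.mem_univ βhat) hβ
    (by norm_num : (0 : ℝ) < 1 / 2) (by norm_num : (0 : ℝ) < 1 / 2) (by norm_num)
  have h2 := key ((1 / 2 : ℝ) • β + (1 / 2 : ℝ) • βhat)
  simp only [smul_eq_mul] at h1
  linarith
end

section
/- Let a, b ∈ ℝ with |a| ≤ 1, b > 0 and a·b < 1/2, and define g(c) = (c²/4 + 1 + a·c)/(b·c + 1)² for c ≥ 0. Then setting c* = 2·max(2b − a, 0)/(1 − 2ab), one has g(c*) ≤ g(c) for every c ≥ 0; that is, c* minimizes g over [0, ∞). In particular, when 2b ≤ a the minimizer is c* = 0. -/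
/-- Equation (20) of the paper: when `|a| ≤ 1`, `b > 0` and `ab < 1/2`, the function
`g(c) = (c²/4 + 1 + ac)/(bc + 1)²` is minimized over `[0, ∞)` at
`c* = 2 max(2b - a, 0)/(1 - 2ab)`; in particular `c* = 0` when `2b ≤ a`. -/
theorem stmt_7 (a b : ℝ) (ha : |a| ≤ 1) (hb : 0 < b) (hab : a * b < 1 / 2)
    (g : ℝ → ℝ) (hg : g = fun c => (c ^ 2 / 4 + 1 + a * c) / (b * c + 1) ^ 2)
    (cstar : ℝ) (hcstar : cstar = 2 * max (2 * b - a) 0 / (1 - 2 * a * b)) :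
    (∀ c : ℝ, 0 ≤ c → g cstar ≤ g c) ∧ (2 * b ≤ a → cstar = 0) := by
  have ha1 := (abs_le.mp ha).1
  have ha2 := (abs_le.mp ha).2
  have hs : 0 < 1 - 2 * a * b := by linarith
  have hz : 2 * b ≤ a → cstar = 0 := by
    intro h
    rw [hcstar, max_eq_right (by linarith)]
    simp
  refine ⟨?_, hz⟩
  intro c hc
  have hc1 : 0 < b * c + 1 := by positivity
  rcases le_or_gt (2 * b) a with h | h
  · rw [hz h, hg]
    simp only
    rw [le_div_iff₀ (by positivity)]
    norm_num
    have h1 : b ^ 2 ≤ 1 / 4 := by nlinarith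
    nlinarith [mul_nonneg (sub_nonneg.mpr h) hc,
      mul_nonneg (sub_nonneg.mpr h1) (sq_nonneg c)]
  · have hD : 0 < 1 - 4 * a * b + 4 * b ^ 2 := by
      have h2 : 0 ≤ 1 - a ^ 2 := by nlinarith
      nlinarith [mul_nonneg (sq_nonneg b) h2, pow_pos hs 2]
    have hval : g cstar = (1 - a ^ 2) / (1 - 4 * a * b + 4 * b ^ 2) := by
      rw [max_eq_left (by linarith)] at hcstar
      have hcs : cstar * (1 - 2 * a * b) = 2 * (2 * b - a) := by
        rw [hcstar]
        exact div_mul_cancel₀ _ hs.ne'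
      have hden : (b * cstar + 1) * (1 - 2 * a * b) = 1 - 4 * a * b + 4 * b ^ 2 := by
        linear_combination b * hcs
      have hne : b * cstar + 1 ≠ 0 := by
        intro h0
        rw [h0] at hden
        linarith
      rw [hg]
      simp only
      rw [div_eq_div_iff (by positivity) hD.ne']
      have hs2 : (1 - 2 * a * b) ^ 2 ≠ 0 := by positivity
      have key : (cstar ^ 2 / 4 + 1 + a * cstar) * (1 - 4 * a * b + 4 * b ^ 2)
          - (1 - a ^ 2) * (b * cstar + 1) ^ 2
          = (cstar * (1 - 2 * a * b) / 2 - (2 * b - a)) ^ 2 := by ring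
      rw [hcs] at key
      linear_combination key
    rw [hval, hg]
    simp only
    rw [div_le_div_iff₀ hD (by positivity)]
    nlinarith [sq_nonneg (c * (1 - 2 * a * b) / 2 - (2 * b - a))]
end

section
/- Let a, b ∈ ℝ with |a| ≤ 1, b > 0, a·b = 1/2, and define g(c) = (c²/4 + 1 + a·c)/(b·c + 1)² for c ≥ 0. Then g(c) = 1/(4b²) + (4b² − 1)/(4b²·(bc + 1)²) for all c ≥ 0. Consequently: (i) if 2b ≤ a, then g(0) ≤ g(c) for all c ≥ 0, so the minimizer over [0, ∞) is c = 0; (ii) if 2b > a, then g is strictly decreasing on [0, ∞), g(c) > 1/(4b²) for every c ≥ 0, and g(c) → 1/(4b²) as c → ∞, so the infimum over [0, ∞) equals 1/(4b²) and is not attained. -/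
open Filter

/-- Boundary case `ab = 1/2` of Section 4.1: the explicit decomposition of
`g(c) = (c²/4 + 1 + ac)/(bc + 1)²`, with the consequences that when `2b ≤ a` the
minimizer over `[0, ∞)` is `c = 0`, while when `2b > a` the function is strictly
decreasing on `[0, ∞)`, always exceeds `1/(4b²)`, tends to `1/(4b²)` at infinity, and
`1/(4b²)` is the (unattained) infimum over `[0, ∞)`. -/
theorem stmt_8 (a b : ℝ) (ha : |a| ≤ 1) (hb : 0 < b) (hab : a * b = 1 / 2)
    (g : ℝ → ℝ) (hg : g = fun c => (c ^ 2 / 4 + 1 + a * c) / (b * c + 1) ^ 2) :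
    (∀ c : ℝ, 0 ≤ c →
        g c = 1 / (4 * b ^ 2) + (4 * b ^ 2 - 1) / (4 * b ^ 2 * (b * c + 1) ^ 2)) ∧
    (2 * b ≤ a → ∀ c : ℝ, 0 ≤ c → g 0 ≤ g c) ∧
    (a < 2 * b →
      StrictAntiOn g (Set.Ici (0 : ℝ)) ∧
      (∀ c : ℝ, 0 ≤ c → 1 / (4 * b ^ 2) < g c) ∧
      Tendsto g atTop (nhds (1 / (4 * b ^ 2))) ∧
      IsGLB (g '' Set.Ici (0 : ℝ)) (1 / (4 * b ^ 2)) ∧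
      1 / (4 * b ^ 2) ∉ g '' Set.Ici (0 : ℝ)) := by
  have key : ∀ c : ℝ, 0 ≤ c →
        g c = 1 / (4 * b ^ 2) + (4 * b ^ 2 - 1) / (4 * b ^ 2 * (b * c + 1) ^ 2) := by
    intro c hc
    have h1 : 0 < b * c + 1 := by positivity
    have ha' : a = 1 / (2 * b) := by
      field_simp
      linarith
    rw [hg, ha']
    field_simp
    ring
  refine ⟨key, ?_, ?_⟩
  · intro h c hc
    have hb1 : 4 * b ^ 2 ≤ 1 := by nlinarith
    have h1 : 1 ≤ b * c + 1 := by nlinarith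
    rw [key 0 le_rfl, key c hc]
    have h2 : (1 - 4 * b ^ 2) / (4 * b ^ 2 * (b * c + 1) ^ 2)
        ≤ (1 - 4 * b ^ 2) / (4 * b ^ 2 * (b * 0 + 1) ^ 2) := by
      apply div_le_div_of_nonneg_left (by linarith) (by positivity)
      apply mul_le_mul_of_nonneg_left _ (by positivity)
      nlinarith
    have e : ∀ x : ℝ, (4 * b ^ 2 - 1) / x = -((1 - 4 * b ^ 2) / x) := by
      intro x
      ring
    rw [e, e]
    linarith
  · intro h
    have hb1 : 0 < 4 * b ^ 2 - 1 := by nlinarith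
    have hlt : ∀ c : ℝ, 0 ≤ c → 1 / (4 * b ^ 2) < g c := by
      intro c hc
      rw [key c hc]
      have : 0 < (4 * b ^ 2 - 1) / (4 * b ^ 2 * (b * c + 1) ^ 2) := by
        have h1 : 0 < b * c + 1 := by positivity
        positivity
      linarith
    have hT : Tendsto g atTop (nhds (1 / (4 * b ^ 2))) := by
      have h1 : Tendsto (fun c : ℝ => b * c + 1) atTop atTop :=
        tendsto_atTop_add_const_right _ _ (tendsto_id.const_mul_atTop hb)
      have h2 : Tendsto (fun c : ℝ => 4 * b ^ 2 * (b * c + 1) ^ 2) atTop atTop :=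
        ((tendsto_pow_atTop two_ne_zero).comp h1).const_mul_atTop (by positivity)
      have h3 := (h2.const_div_atTop (4 * b ^ 2 - 1)).const_add (1 / (4 * b ^ 2))
      rw [add_zero] at h3
      refine h3.congr' ?_
      filter_upwards [eventually_ge_atTop 0] with c hc
      exact (key c hc).symm
    refine ⟨?_, hlt, hT, ⟨?_, ?_⟩, ?_⟩
    · intro x hx y hy hxy
      have hx : 0 ≤ x := hx
      have hy : 0 ≤ y := hy
      rw [key x hx, key y hy]
      have h1 : 0 < b * x + 1 := by positivity
      gcongr
    · rintro _ ⟨c, hc, rfl⟩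
      exact (hlt c hc).le
    · intro m hm
      refine ge_of_tendsto hT ?_
      filter_upwards [eventually_ge_atTop 0] with c hc
      exact hm ⟨c, hc, rfl⟩
    · rintro ⟨c, hc, h⟩
      exact (hlt c hc).ne' h
end

section
/- Let a, b ∈ ℝ with |a| ≤ 1, b > 0, and D := 4b² − 4ab + 1 > 0, and define g(c) = (c²/4 + 1 + a·c)/(b·c + 1)² for all real c with b·c + 1 ≠ 0. Then g(c) ≥ (1 − a²)/D for every c with b·c + 1 ≠ 0. Moreover, if a·b ≠ 1/2, then the minimum is attained at c_opt = 2(2b − a)/(1 − 2ab): one has b·c_opt + 1 ≠ 0 and g(c_opt) = (1 − a²)/D. -/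
/-- Equations (21)–(23) of the paper: with `D = 4b² - 4ab + 1 > 0`, the function
`g(c) = (c²/4 + 1 + ac)/(bc + 1)²` satisfies `g(c) ≥ (1 - a²)/D` wherever defined, and
when `ab ≠ 1/2` the minimum is attained at `c_opt = 2(2b - a)/(1 - 2ab)` with
`g(c_opt) = (1 - a²)/D`. -/
theorem stmt_9 (a b : ℝ) (ha : |a| ≤ 1) (hb : 0 < b)
    (hD : 0 < 4 * b ^ 2 - 4 * a * b + 1)
    (g : ℝ → ℝ) (hg : g = fun c => (c ^ 2 / 4 + 1 + a * c) / (b * c + 1) ^ 2) :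
    (∀ c : ℝ, b * c + 1 ≠ 0 →
        (1 - a ^ 2) / (4 * b ^ 2 - 4 * a * b + 1) ≤ g c) ∧
    (a * b ≠ 1 / 2 →
      b * (2 * (2 * b - a) / (1 - 2 * a * b)) + 1 ≠ 0 ∧
      g (2 * (2 * b - a) / (1 - 2 * a * b)) =
        (1 - a ^ 2) / (4 * b ^ 2 - 4 * a * b + 1)) := by
  subst hg
  have key : ∀ c : ℝ, (c ^ 2 / 4 + 1 + a * c) * (4 * b ^ 2 - 4 * a * b + 1)
      - (1 - a ^ 2) * (b * c + 1) ^ 2 = ((1 / 2 - a * b) * c - (2 * b - a)) ^ 2 := by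
    intro c
    ring
  refine ⟨fun c hc => ?_, fun hab => ?_⟩
  · have hc2 : 0 < (b * c + 1) ^ 2 := by positivity
    show _ ≤ (c ^ 2 / 4 + 1 + a * c) / (b * c + 1) ^ 2
    rw [div_le_div_iff₀ hD hc2]
    have := sq_nonneg ((1 / 2 - a * b) * c - (2 * b - a))
    linarith [key c]
  · have h1 : 1 - 2 * a * b ≠ 0 := fun h => hab (by linarith)
    have h2 : (1 - 2 * a * b) * (2 * (2 * b - a) / (1 - 2 * a * b)) = 2 * (2 * b - a) :=
      mul_div_cancel₀ _ h1
    generalize 2 * (2 * b - a) / (1 - 2 * a * b) = c at h2 ⊢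
    have hc : b * c + 1 ≠ 0 := by
      intro h
      have h3 : (1 - 2 * a * b) * (b * c + 1) = 4 * b ^ 2 - 4 * a * b + 1 := by
        linear_combination b * h2
      rw [h, mul_zero] at h3
      linarith
    refine ⟨hc, ?_⟩
    show (c ^ 2 / 4 + 1 + a * c) / (b * c + 1) ^ 2 = _
    rw [div_eq_div_iff (pow_ne_zero 2 hc) hD.ne']
    have h4 : (1 / 2 - a * b) * c - (2 * b - a) = 0 := by linear_combination h2 / 2
    have h5 := key c
    rw [h4] at h5
    linarith
end
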